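/- (Equivalence of enumeration and learning, minimum part.) Let n, m be natural numbers, let p : Fin m → ℝ satisfy 0 ≤ p i ≤ 1 for all i, and let ψ : (Fin n → Bool) → (Fin m → Bool) → Bool. For each σ₀ : Fin n → Bool let Φ_{σ₀} be the RE-SSAT instance with randomized quantifiers R^{p i} over the m inner variables followed by existential quantifiers over the n outer variables and matrix (σ, x) ↦ (ψ σ x ∧ σ = σ₀), and let Φ_UR be the UR-SSAT instance with universal quantifiers over the n outer variables followed by the same randomized quantifiers and matrix ψ. Then min over σ₀ : Fin n → Bool of val(Φ_{σ₀}) = val(Φ_UR). -/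

import Mathlib

noncomputable section

/-- Value of a block of randomized quantifiers `R^{p 0}, …, R^{p (m-1)}`,
applied (outermost first) to the real-valued value function `g`:
`val(R^p b · Q, ψ) = p * val(Q, ψ[b:=true]) + (1-p) * val(Q, ψ[b:=false])`. -/
def rVal : (m : ℕ) → (Fin m → ℝ) → ((Fin m → Bool) → ℝ) → ℝ
  | 0, _, g => g (fun i => i.elim0)
  | m + 1, p, g =>
      p 0 * rVal m (fun i => p i.succ) (fun x => g (Fin.cons true x)) +
      (1 - p 0) * rVal m (fun i => p i.succ) (fun x => g (Fin.cons false x))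

/-- Value of a block of existential quantifiers applied to `g`:
`val(∃ b · Q, ψ) = max (val(Q, ψ[b:=true])) (val(Q, ψ[b:=false]))`. -/
def exVal : (n : ℕ) → ((Fin n → Bool) → ℝ) → ℝ
  | 0, g => g (fun i => i.elim0)
  | n + 1, g =>
      max (exVal n (fun σ => g (Fin.cons true σ)))
        (exVal n (fun σ => g (Fin.cons false σ)))

/-- Value of a block of universal quantifiers applied to `g`:
`val(∀ b · Q, ψ) = min (val(Q, ψ[b:=true])) (val(Q, ψ[b:=false]))`. -/
def allVal : (n : ℕ) → ((Fin n → Bool) → ℝ) → ℝ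
  | 0, g => g (fun i => i.elim0)
  | n + 1, g =>
      min (allVal n (fun σ => g (Fin.cons true σ)))
        (allVal n (fun σ => g (Fin.cons false σ)))

/-- Product Bernoulli measure `μ_p` of a set `S` of assignments:
`μ_p(S) = ∑_{x ∈ S} ∏_i (if x i then p i else 1 - p i)`. -/
def mu (m : ℕ) (p : Fin m → ℝ) (S : Set (Fin m → Bool)) : ℝ :=
  ∑ x : Fin m → Bool,
    Set.indicator S (fun y => ∏ i, (if y i then p i else 1 - p i)) x

theorem le_exVal {n : ℕ} (g : (Fin n → Bool) → ℝ) (σ : Fin n → Bool) : g σ ≤ exVal n g := by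
  induction n with
  | zero => exact (congrArg g (Subsingleton.elim _ _)).le
  | succ n ih =>
    rw [← Fin.cons_self_tail σ]
    cases σ 0
    · exact (ih (fun τ => g (Fin.cons false τ)) _).trans (le_max_right _ _)
    · exact (ih (fun τ => g (Fin.cons true τ)) _).trans (le_max_left _ _)

theorem exVal_le {n : ℕ} {g : (Fin n → Bool) → ℝ} {c : ℝ} (h : ∀ σ, g σ ≤ c) :
    exVal n g ≤ c := by
  induction n with
  | zero => exact h _
  | succ n ih => exact max_le (ih fun _ => h _) (ih fun _ => h _)

theorem allVal_le {n : ℕ} (g : (Fin n → Bool) → ℝ) (σ : Fin n → Bool) : allVal n g ≤ g σ := by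
  induction n with
  | zero => exact (congrArg g (Subsingleton.elim _ _)).le
  | succ n ih =>
    rw [← Fin.cons_self_tail σ]
    cases σ 0
    · exact (min_le_right _ _).trans (ih (fun τ => g (Fin.cons false τ)) _)
    · exact (min_le_left _ _).trans (ih (fun τ => g (Fin.cons true τ)) _)

theorem le_allVal {n : ℕ} {g : (Fin n → Bool) → ℝ} {c : ℝ} (h : ∀ σ, c ≤ g σ) :
    c ≤ allVal n g := by
  induction n with
  | zero => exact h _
  | succ n ih => exact le_min (ih fun _ => h _) (ih fun _ => h _)

theorem inf'_univ_eq_allVal {n : ℕ} (g : (Fin n → Bool) → ℝ) :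
    Finset.univ.inf' Finset.univ_nonempty g = allVal n g :=
  le_antisymm (le_allVal fun σ => Finset.inf'_le g (Finset.mem_univ σ))
    (Finset.le_inf' _ _ fun σ _ => allVal_le g σ)

theorem exVal_and_eq {n : ℕ} (φ : (Fin n → Bool) → Bool) (σ₀ : Fin n → Bool) :
    exVal n (fun σ => if φ σ ∧ σ = σ₀ then (1 : ℝ) else 0) = if φ σ₀ then 1 else 0 := by
  apply le_antisymm
  · refine exVal_le fun σ => ?_
    by_cases h : σ = σ₀
    · simp [h]
    · simp only [h, and_false, if_false]
      split_ifs <;> norm_num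
  · simpa using le_exVal (fun σ => if φ σ ∧ σ = σ₀ then (1 : ℝ) else 0) σ₀

/-- Equivalence of enumeration and learning (minimum part): the minimum over
`σ₀` of the values of the RE-SSAT instances `Φ_{σ₀}` (randomized quantifiers
over the inner variables, then existential quantifiers over the outer
variables, matrix `(σ, x) ↦ ψ σ x ∧ σ = σ₀`) equals the value of the UR-SSAT
instance `Φ_UR` (universal quantifiers over the outer variables, then the
same randomized quantifiers, matrix `ψ`). -/
theorem enum_eq_learn_min (n m : ℕ) (p : Fin m → ℝ)
    (hp : ∀ i, 0 ≤ p i ∧ p i ≤ 1)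
    (ψ : (Fin n → Bool) → (Fin m → Bool) → Bool) :
    Finset.univ.inf' Finset.univ_nonempty
        (fun σ₀ : Fin n → Bool =>
          rVal m p (fun x =>
            exVal n (fun σ => if ψ σ x ∧ σ = σ₀ then (1 : ℝ) else 0))) =
      allVal n (fun σ => rVal m p (fun x => if ψ σ x then (1 : ℝ) else 0)) := by
  rw [inf'_univ_eq_allVal]
  congr! 4 with σ₀ x
  exact exVal_and_eq (fun σ => ψ σ x) σ₀
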